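/- arXiv:2107.05131 — 3 statements merged into one kernel-verified Lean document; each statement's English description precedes it below -/
import Mathlib

section
/- Let G=(S,T;E) be a finite bipartite graph admitting a (1,2)-factor, and suppose |N(Y)| ≥ 2|Y| + 2 for every nonempty proper subset Y ⊊ T. Then for every buyer t ∈ T and every pair of distinct items s_1, s_2 ∈ N(t), there exists a (1,2)-factor M of G with N_M(t) = {s_1, s_2}. -/
open Finset

variable {S T : Type*} [DecidableEq S] [DecidableEq T]

/-- The number of edges of `M` incident to the item `s`. -/
def degS (M : Finset (S × T)) (s : S) : ℕ := (M.filter fun e => e.1 = s).card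

/-- The number of edges of `M` incident to the buyer `t`. -/
def degT (M : Finset (S × T)) (t : T) : ℕ := (M.filter fun e => e.2 = t).card

/-- The set of items adjacent (via the edge set `E`) to some buyer in `X`. -/
def nbhd (E : Finset (S × T)) (X : Finset T) : Finset S :=
  (E.filter fun e => e.2 ∈ X).image Prod.fst

/-- **Case 1 of Theorem 5.1.** If `|N(Y)| ≥ 2|Y| + 2` for every nonempty
proper `Y ⊊ T` and `G` admits a `(1,2)`-factor, then every pair of neighbors of any
buyer is feasible for that buyer. -/
theorem stmt17 [Fintype S] [Fintype T]
    (E : Finset (S × T))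
    (hfac : ∃ M ⊆ E, (∀ s, degS M s = 1) ∧ ∀ t, degT M t = 2)
    (hN : ∀ Y : Finset T, Y.Nonempty → Y ≠ univ → 2 * Y.card + 2 ≤ (nbhd E Y).card) :
    ∀ t : T, ∀ s₁ ∈ nbhd E {t}, ∀ s₂ ∈ nbhd E {t}, s₁ ≠ s₂ →
      ∃ M ⊆ E, (∀ s, degS M s = 1) ∧ (∀ t', degT M t' = 2) ∧
        nbhd M {t} = {s₁, s₂} := by
  classical
  intro t s₁ hs₁ s₂ hs₂ hne
  have memN : ∀ (F : Finset (S × T)) (X : Finset T) (s : S),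
      s ∈ nbhd F X ↔ ∃ u ∈ X, (s, u) ∈ F := by
    intro F X s
    simp only [nbhd, mem_image, mem_filter, Prod.exists]
    constructor
    · rintro ⟨a, b, ⟨h1, h2⟩, rfl⟩
      exact ⟨b, h2, h1⟩
    · rintro ⟨u, h1, h2⟩
      exact ⟨s, u, ⟨h2, h1⟩, rfl⟩
  have hcard : Fintype.card (T × Bool) = Fintype.card S := by
    obtain ⟨M, -, hS, hT⟩ := hfac
    have h1 : M.card = ∑ s : S, degS M s :=
      card_eq_sum_card_fiberwise (f := Prod.fst) (t := univ) (by intro x _; simp)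
    have h2 : M.card = ∑ u : T, degT M u :=
      card_eq_sum_card_fiberwise (f := Prod.snd) (t := univ) (by intro x _; simp)
    simp only [hS, hT, sum_const, card_univ, smul_eq_mul] at h1 h2
    simp only [Fintype.card_prod, Fintype.card_bool]
    omega
  let r : T × Bool → Finset S := fun x =>
    if x.1 = t then (if x.2 then {s₁} else {s₂}) else nbhd E {x.1} \ {s₁, s₂}
  have hall : ∀ A : Finset (T × Bool), A.card ≤ (A.biUnion r).card := by
    intro A
    let B := A.filter fun x => x.1 = t
    let C := A.filter fun x => ¬ x.1 = t
    let Y := C.image Prod.fst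
    let g : T × Bool → S := fun x => if x.2 then s₁ else s₂
    have hABC : B.card + C.card = A.card := card_filter_add_card_filter_not _
    have hC : C.card ≤ 2 * Y.card := by
      have : C ⊆ Y ×ˢ (univ : Finset Bool) := by
        intro x hx
        simp only [mem_product, mem_univ, and_true]
        exact mem_image_of_mem _ hx
      have := card_le_card this
      rw [card_product] at this
      simp at this
      omega
    have htY : t ∉ Y := by simp [Y, C]
    have hY : 2 * Y.card ≤ (nbhd E Y \ {s₁, s₂}).card := by
      rcases Y.eq_empty_or_nonempty with h | h
      · simp [h]
      · have h1 := hN Y h (fun h => htY (h ▸ mem_univ t))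
        have h2 := le_card_sdiff ({s₁, s₂} : Finset S) (nbhd E Y)
        have h3 : ({s₁, s₂} : Finset S).card = 2 := card_pair hne
        omega
    have hB : (B.image g).card = B.card := by
      apply card_image_of_injOn
      rintro ⟨a, b⟩ hx ⟨c, d⟩ hy hxy
      simp only [B, coe_filter, Set.mem_setOf_eq] at hx hy
      have h1 := hx.2
      have h2 := hy.2
      subst h1
      subst h2
      cases b <;> cases d <;> simp_all [g]
    have hdis : Disjoint (B.image g) (nbhd E Y \ {s₁, s₂}) := by
      rw [disjoint_left]
      intro s hs hs'
      obtain ⟨x, -, rfl⟩ := mem_image.1 hs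
      rw [mem_sdiff] at hs'
      apply hs'.2
      simp only [g]
      split_ifs <;> simp
    have hsub : B.image g ∪ (nbhd E Y \ {s₁, s₂}) ⊆ A.biUnion r := by
      intro s hs
      rw [mem_biUnion]
      rcases mem_union.1 hs with hs | hs
      · obtain ⟨x, hx, rfl⟩ := mem_image.1 hs
        obtain ⟨hx1, hx2⟩ := mem_filter.1 hx
        refine ⟨x, hx1, ?_⟩
        simp only [r, g, if_pos hx2]
        split_ifs <;> simp
      · obtain ⟨h1, h2⟩ := mem_sdiff.1 hs
        obtain ⟨u, hu, hsu⟩ := (memN _ _ _).1 h1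
        obtain ⟨x, hx, rfl⟩ := mem_image.1 hu
        obtain ⟨hx1, hx2⟩ := mem_filter.1 hx
        refine ⟨x, hx1, ?_⟩
        simp only [r, if_neg hx2]
        exact mem_sdiff.2 ⟨(memN _ _ _).2 ⟨x.1, mem_singleton_self _, hsu⟩, h2⟩
    have := card_le_card hsub
    rw [card_union_of_disjoint hdis] at this
    omega
  obtain ⟨f, hf, hfr⟩ := (Finset.all_card_le_biUnion_card_iff_exists_injective r).1 hall
  have hbij : Function.Bijective f := (Fintype.bijective_iff_injective_and_card f).2 ⟨hf, hcard⟩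
  have ht1 : f (t, true) = s₁ := by simpa [r] using hfr (t, true)
  have ht2 : f (t, false) = s₂ := by simpa [r] using hfr (t, false)
  have memM : ∀ s u, (s, u) ∈ (univ.image fun x : T × Bool => (f x, x.1)) ↔
      s = f (u, true) ∨ s = f (u, false) := by
    intro s u
    simp only [mem_image, mem_univ, true_and, Prod.mk.injEq, Prod.exists]
    constructor
    · rintro ⟨a, b, rfl, rfl⟩
      cases b <;> simp
    · rintro (h | h)
      · exact ⟨u, true, h.symm, rfl⟩
      · exact ⟨u, false, h.symm, rfl⟩
  refine ⟨univ.image fun x : T × Bool => (f x, x.1), ?_, ?_, ?_, ?_⟩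
  · intro e he
    obtain ⟨⟨u, b⟩, -, rfl⟩ := mem_image.1 he
    have h := hfr (u, b)
    have key : f (u, b) ∈ nbhd E {u} := by
      by_cases hu : u = t
      · subst hu
        cases b
        · rwa [ht2]
        · rwa [ht1]
      · simp only [r, if_neg hu] at h
        exact (mem_sdiff.1 h).1
    simpa [memN] using key
  · intro s
    obtain ⟨x, rfl⟩ := hbij.2 s
    rw [degS, card_eq_one]
    refine ⟨(f x, x.1), ?_⟩
    ext e
    simp only [mem_filter, mem_image, mem_univ, true_and, mem_singleton]
    constructor
    · rintro ⟨⟨y, rfl⟩, h⟩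
      rw [hf h]
    · rintro rfl
      exact ⟨⟨x, rfl⟩, rfl⟩
  · intro u
    rw [degT, card_eq_two]
    refine ⟨(f (u, true), u), (f (u, false), u), ?_, ?_⟩
    · intro h
      have := hf (Prod.mk.inj h).1
      simp at this
    · ext ⟨s, v⟩
      simp only [mem_filter, memM, mem_insert, mem_singleton, Prod.mk.injEq]
      constructor
      · rintro ⟨h, rfl⟩
        simpa using h
      · rintro (⟨h, rfl⟩ | ⟨h, rfl⟩) <;> simp [h]
  · ext s
    simp only [memN, mem_singleton, exists_eq_left, memM, ht1, ht2, mem_insert]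
end

section
/- Let G=(S,T;E) be a finite bipartite graph admitting a (1,2)-factor, and suppose |N(Y)| ≥ 2|Y| + 1 for every nonempty proper subset Y ⊊ T. Then for every buyer t ∈ T and every pair of distinct items s_1, s_2 ∈ N(t), there is no (1,2)-factor M of G with N_M(t) = {s_1, s_2} if and only if there exists a dangerous set Y ⊆ T − t with s_1, s_2 ∈ N(Y). -/
open Finset

variable {S T : Type*} [DecidableEq S] [DecidableEq T]

theorem mem_nbhd_iff (E : Finset (S × T)) (X : Finset T) (s : S) :
    s ∈ nbhd E X ↔ ∃ x ∈ X, (s, x) ∈ E := by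
  simp only [nbhd, mem_image, mem_filter, Prod.exists]
  constructor
  · rintro ⟨a, b, ⟨h1, h2⟩, rfl⟩
    exact ⟨b, h2, h1⟩
  · rintro ⟨x, h1, h2⟩
    exact ⟨s, x, ⟨h2, h1⟩, rfl⟩

theorem factor_nbhd_card (M : Finset (S × T)) (h1 : ∀ s, degS M s = 1)
    (h2 : ∀ t, degT M t = 2) (Y : Finset T) : (nbhd M Y).card = 2 * Y.card := by
  unfold nbhd
  rw [card_image_of_injOn]
  · rw [card_eq_sum_card_fiberwise (f := Prod.snd) (t := Y)]
    · rw [sum_congr rfl (g := fun _ => 2)]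
      · simp [mul_comm]
      · intro x hx
        rw [← h2 x, degT, filter_filter]
        congr 1
        ext e
        simp only [mem_filter]
        constructor
        · rintro ⟨a, b, c⟩
          exact ⟨a, c⟩
        · rintro ⟨a, c⟩
          exact ⟨a, c ▸ hx, c⟩
    · intro e he
      simpa using (mem_filter.1 he).2
  · intro a ha b hb hab
    have := h1 a.1
    rw [degS] at this
    refine card_le_one.1 this.le a ?_ b ?_
    · exact mem_filter.2 ⟨(mem_filter.1 ha).1, rfl⟩
    · exact mem_filter.2 ⟨(mem_filter.1 hb).1, hab.symm⟩

theorem factor_of_bij [Fintype T] (g : T × Bool → S) (hg : Function.Bijective g) :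
    (∀ s, degS (univ.image fun i => (g i, i.1)) s = 1) ∧
    (∀ t, degT (univ.image fun i => (g i, i.1)) t = 2) := by
  constructor
  · intro s
    obtain ⟨i, rfl⟩ := hg.2 s
    rw [degS, card_eq_one]
    refine ⟨(g i, i.1), ?_⟩
    ext e
    simp only [mem_filter, mem_image, mem_univ, true_and, mem_singleton]
    constructor
    · rintro ⟨⟨j, rfl⟩, h⟩
      rw [hg.1 h]
    · rintro rfl
      exact ⟨⟨i, rfl⟩, rfl⟩
  · intro t
    rw [degT, card_eq_two]
    refine ⟨(g (t, false), t), (g (t, true), t), ?_, ?_⟩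
    · intro h
      have := hg.1 (Prod.ext_iff.1 h).1
      simp at this
    · ext e
      simp only [mem_filter, mem_image, mem_univ, true_and, mem_insert, mem_singleton]
      constructor
      · rintro ⟨⟨⟨x, b⟩, rfl⟩, h⟩
        simp only at h
        subst h
        cases b <;> simp
      · rintro (rfl | rfl)
        · exact ⟨⟨_, rfl⟩, rfl⟩
        · exact ⟨⟨_, rfl⟩, rfl⟩

set_option maxHeartbeats 1000000

/-- Under `|N(Y)| ≥ 2|Y| + 1` for every nonempty proper `Y ⊊ T`, a pair
of distinct neighbors `s₁, s₂` of a buyer `t` is infeasible for `t` iff some dangerous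
set `Y ⊆ T − t` has both `s₁` and `s₂` in its neighborhood. -/
theorem stmt18 [Fintype S] [Fintype T]
    (E : Finset (S × T))
    (hfac : ∃ M ⊆ E, (∀ s, degS M s = 1) ∧ ∀ t, degT M t = 2)
    (hN : ∀ Y : Finset T, Y.Nonempty → Y ≠ univ → 2 * Y.card + 1 ≤ (nbhd E Y).card) :
    ∀ t : T, ∀ s₁ ∈ nbhd E {t}, ∀ s₂ ∈ nbhd E {t}, s₁ ≠ s₂ →
      ((¬∃ M ⊆ E, (∀ s, degS M s = 1) ∧ (∀ t', degT M t' = 2) ∧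
          nbhd M {t} = {s₁, s₂}) ↔
        ∃ Y : Finset T, t ∉ Y ∧ (nbhd E Y).card = 2 * Y.card + 1 ∧
          s₁ ∈ nbhd E Y ∧ s₂ ∈ nbhd E Y) := by
  obtain ⟨M0, -, hM1, hM2⟩ := hfac
  have hcard : Fintype.card S = 2 * Fintype.card T := by
    have h := factor_nbhd_card M0 hM1 hM2 univ
    have hu : nbhd M0 univ = univ := by
      ext s
      simp only [mem_univ, iff_true, mem_nbhd_iff, true_and]
      have := hM1 s
      rw [degS] at this
      obtain ⟨e, he⟩ := card_pos.1 (by rw [this]; exact one_pos)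
      rw [mem_filter] at he
      obtain ⟨he, rfl⟩ := he
      exact ⟨e.2, he⟩
    rwa [hu, card_univ, card_univ] at h
  intro t s₁ hs₁ s₂ hs₂ hne
  constructor
  · intro hno
    by_contra hY
    apply hno
    let F : {x : T // x ≠ t} × Bool → Finset S := fun i => nbhd E {i.1.1} \ {s₁, s₂}
    have hall : ∀ A : Finset ({x : T // x ≠ t} × Bool), A.card ≤ (A.biUnion F).card := by
      intro A
      let Y : Finset T := A.image fun i => i.1.1
      have htY : t ∉ Y := by
        intro h
        obtain ⟨i, -, hi⟩ := mem_image.1 h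
        exact i.1.2 hi
      have hA : A.card ≤ 2 * Y.card := by
        have : (A.image fun i => (i.1.1, i.2)) ⊆ Y ×ˢ (univ : Finset Bool) := by
          intro p hp
          obtain ⟨i, hi, rfl⟩ := mem_image.1 hp
          exact mem_product.2 ⟨mem_image.2 ⟨i, hi, rfl⟩, mem_univ _⟩
        have h2 := card_le_card this
        rw [card_product, card_image_of_injective] at h2
        · simp at h2
          omega
        · rintro ⟨⟨a, ha⟩, b⟩ ⟨⟨c, hc⟩, d⟩ h
          simpa using h
      have hsub : nbhd E Y \ {s₁, s₂} ⊆ A.biUnion F := by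
        intro s hs
        rw [mem_sdiff, mem_nbhd_iff] at hs
        obtain ⟨⟨x, hx, hxE⟩, hs⟩ := hs
        obtain ⟨i, hi, rfl⟩ := mem_image.1 hx
        refine mem_biUnion.2 ⟨i, hi, mem_sdiff.2 ⟨?_, hs⟩⟩
        rw [mem_nbhd_iff]
        exact ⟨_, mem_singleton_self _, hxE⟩
      have hle := card_le_card hsub
      refine hA.trans (le_trans ?_ hle)
      rcases Y.eq_empty_or_nonempty with h0 | h0
      · simp [h0]
      have hbig := hN Y h0 (fun h => htY (h ▸ mem_univ t))
      have hI := card_sdiff_add_card_inter (nbhd E Y) {s₁, s₂}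
      have hI2 : (nbhd E Y ∩ {s₁, s₂}).card ≤ 2 :=
        (card_le_card inter_subset_right).trans card_le_two
      by_cases hb : s₁ ∈ nbhd E Y ∧ s₂ ∈ nbhd E Y
      · have : (nbhd E Y).card ≠ 2 * Y.card + 1 := fun h => hY ⟨Y, htY, h, hb⟩
        omega
      · have : (nbhd E Y ∩ {s₁, s₂}).card ≤ 1 := by
          rw [card_le_one]
          intro a ha b hb'
          simp only [mem_inter, mem_insert, mem_singleton] at ha hb'
          grind
        omega
    obtain ⟨f, hf, hfF⟩ := (all_card_le_biUnion_card_iff_exists_injective F).1 hall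
    have hfF' : ∀ i, f i ∈ nbhd E {i.1.1} ∧ f i ≠ s₁ ∧ f i ≠ s₂ := by
      intro i
      have := hfF i
      simpa [F] using this
    let g : T × Bool → S := fun i =>
      if h : i.1 = t then (if i.2 then s₁ else s₂) else f (⟨i.1, h⟩, i.2)
    have hgt : ∀ b, g (t, b) = if b then s₁ else s₂ := fun b => by simp [g]
    have hgn : ∀ x b (h : x ≠ t), g (x, b) = f (⟨x, h⟩, b) := fun x b h => by simp [g, h]
    have hinj : Function.Injective g := by
      rintro ⟨x, b⟩ ⟨y, c⟩ h
      by_cases hx : x = t <;> by_cases hy : y = t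
      · subst hx
        subst hy
        rw [hgt, hgt] at h
        cases b <;> cases c <;> simp_all
      · subst hx
        rw [hgt, hgn _ _ hy] at h
        have := hfF' (⟨y, hy⟩, c)
        cases b <;> simp_all
      · subst hy
        rw [hgt, hgn _ _ hx] at h
        have := hfF' (⟨x, hx⟩, b)
        cases c <;> simp_all
      · rw [hgn _ _ hx, hgn _ _ hy] at h
        simpa using hf h
    have hbij : Function.Bijective g := by
      rw [Fintype.bijective_iff_injective_and_card]
      refine ⟨hinj, ?_⟩
      rw [Fintype.card_prod, hcard, Fintype.card_bool, mul_comm]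
    have hedge : ∀ x b, (g (x, b), x) ∈ E := by
      intro x b
      have : g (x, b) ∈ nbhd E {x} := by
        by_cases hx : x = t
        · subst hx
          rw [hgt]
          cases b <;> simpa
        · rw [hgn _ _ hx]
          exact (hfF' (⟨x, hx⟩, b)).1
      rw [mem_nbhd_iff] at this
      simpa using this
    refine ⟨univ.image fun i => (g i, i.1), ?_, (factor_of_bij g hbij).1,
      (factor_of_bij g hbij).2, ?_⟩
    · intro e he
      obtain ⟨⟨x, b⟩, -, rfl⟩ := mem_image.1 he
      exact hedge x b
    · ext s
      rw [mem_nbhd_iff]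
      simp only [mem_singleton, exists_eq_left, mem_image, mem_univ, true_and, mem_insert]
      constructor
      · rintro ⟨⟨x, b⟩, h⟩
        obtain ⟨h1, h2⟩ := Prod.ext_iff.1 h
        simp only at h1 h2
        subst h2
        rw [hgt] at h1
        cases b
        · exact Or.inr (by simpa using h1.symm)
        · exact Or.inl (by simpa using h1.symm)
      · rintro (rfl | rfl)
        · exact ⟨(t, true), by simp [hgt]⟩
        · exact ⟨(t, false), by simp [hgt]⟩
  · rintro ⟨Y, htY, hYc, h1, h2⟩ ⟨M, hME, hS, hT, hMt⟩
    have hc := factor_nbhd_card M hS hT (insert t Y)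
    have hsub : nbhd M (insert t Y) ⊆ nbhd E Y := by
      intro s hs
      rw [mem_nbhd_iff] at hs
      obtain ⟨x, hx, hxM⟩ := hs
      rcases mem_insert.1 hx with rfl | hx
      · have : s ∈ nbhd M {x} := (mem_nbhd_iff _ _ _).2 ⟨x, mem_singleton_self _, hxM⟩
        rw [hMt, mem_insert, mem_singleton] at this
        rcases this with rfl | rfl <;> assumption
      · exact (mem_nbhd_iff _ _ _).2 ⟨x, hx, hME hxM⟩
    have := card_le_card hsub
    rw [hc, card_insert_of_notMem htY] at this
    omega
end

section
/- Let G=(S,T;E) be a finite bipartite graph with T = {t_1, t_2}, let b(t_1)=b_1 and b(t_2)=b_2 be the buyers' demands and b(s)=1 for every item, and suppose G admits a b-factor. Then any ordering σ: S → {1,…,|S|} in which every item of the symmetric difference N(t_1) △ N(t_2) precedes every item of N(t_1) ∩ N(t_2) is adequate: for each i ∈ {1,2} there exists a b-factor M of G with N_M(t_i) equal to the set of the b_i neighbors s of t_i with smallest σ(s). -/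
open Finset

variable {S T : Type*} [DecidableEq S] [DecidableEq T]

/-- `σ` is an adequate ordering of the items for the bipartite graph with edge set `H`
and demands `b` (items having demand `1`): for every buyer `t` there exists a
`b`-factor `M` of `H` matching `t` exactly to the set of its `b t` neighbors in `H`
that come first in the ordering `σ`. -/
def Adequate [Fintype S] (σ : S ≃ Fin (Fintype.card S)) (H : Finset (S × T))
    (b : T → ℕ) : Prop :=
  ∀ t : T, ∃ M ⊆ H, (∀ s, degS M s = 1) ∧ (∀ t', degT M t' = b t') ∧
    ∀ s ∈ nbhd M {t}, ∀ s' ∈ nbhd H {t} \ nbhd M {t}, σ s < σ s'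


/-- Existence of initial segments of prescribed size. -/
theorem exists_initial {S : Type*} [DecidableEq S] {n : ℕ} (σ : S ≃ Fin n) (N : Finset S)
    (k : ℕ) (hk : k ≤ N.card) :
    ∃ Z ⊆ N, Z.card = k ∧ ∀ s ∈ Z, ∀ s' ∈ N \ Z, σ s < σ s' := by
  induction k with
  | zero => exact ⟨∅, by simp, by simp, by simp⟩
  | succ k ih =>
    obtain ⟨Z, hZ, hc, hlt⟩ := ih (by omega)
    have hne : (N \ Z).Nonempty := by
      rw [← Finset.card_pos, Finset.card_sdiff_of_subset hZ]; omega
    obtain ⟨m, hm, hmin⟩ := Finset.exists_min_image (N \ Z) σ hne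
    have hm' := Finset.mem_sdiff.1 hm
    refine ⟨insert m Z, Finset.insert_subset hm'.1 hZ, ?_, ?_⟩
    · rw [Finset.card_insert_of_notMem hm'.2, hc]
    · intro s hs s' hs'
      simp only [Finset.mem_sdiff, Finset.mem_insert, not_or] at hs hs'
      have h3 : s' ∈ N \ Z := Finset.mem_sdiff.2 ⟨hs'.1, hs'.2.2⟩
      rcases hs with rfl | hs
      · refine lt_of_le_of_ne (hmin s' h3) ?_
        intro h
        exact hs'.2.1 (σ.injective h).symm
      · exact hlt s hs s' h3

theorem mem_nbhd_single {S T : Type*} [DecidableEq S] [DecidableEq T]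
    (E : Finset (S × T)) (t : T) (s : S) :
    s ∈ nbhd E {t} ↔ (s, t) ∈ E := by
  simp [nbhd]

theorem card_nbhd_single {S T : Type*} [DecidableEq S] [DecidableEq T]
    (E : Finset (S × T)) (t : T) : (nbhd E {t}).card = degT E t := by
  unfold nbhd degT
  rw [Finset.card_image_of_injOn]
  · simp
  · rintro ⟨a, b⟩ h ⟨c, d⟩ h' hh
    simp_all

theorem adequate_aux {S : Type*} [Fintype S] [DecidableEq S]
    (E : Finset (S × Fin 2)) (b : Fin 2 → ℕ)
    (hfac : ∃ M ⊆ E, (∀ s, degS M s = 1) ∧ ∀ i, degT M i = b i)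
    (σ : S ≃ Fin (Fintype.card S)) (t u : Fin 2) (htu : t ≠ u) (hall : ∀ i, i = t ∨ i = u)
    (hσ : ∀ s, (s, t) ∈ E → (s, u) ∉ E → ∀ s', (s', t) ∈ E → (s', u) ∈ E → σ s < σ s') :
    ∃ M ⊆ E, (∀ s, degS M s = 1) ∧ (∀ t', degT M t' = b t') ∧
    ∀ s ∈ nbhd M {t}, ∀ s' ∈ nbhd E {t} \ nbhd M {t}, σ s < σ s' := by
  obtain ⟨M, hME, hS, hT⟩ := hfac
  have hMc : ∀ i, (nbhd M {i}).card = b i := fun i => by rw [card_nbhd_single, hT]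
  have hex : ∀ s, (s, t) ∈ M ∨ (s, u) ∈ M := by
    intro s
    have h1 : 0 < (M.filter fun e => e.1 = s).card := by
      have := hS s
      unfold degS at this
      omega
    obtain ⟨⟨a, i⟩, hi⟩ := Finset.card_pos.1 h1
    simp only [Finset.mem_filter] at hi
    obtain ⟨hi, rfl⟩ := hi
    rcases hall i with rfl | rfl
    · exact Or.inl hi
    · exact Or.inr hi
  have hnot : ∀ s, (s, t) ∈ M → (s, u) ∉ M := by
    intro s h1 h2
    have h3 := Finset.card_le_one.1 (le_of_eq (hS s)) (s, t) (by simp [h1]) (s, u) (by simp [h2])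
    simp at h3
    exact htu h3
  have hcompl : nbhd M {u} = (nbhd M {t})ᶜ := by
    ext s
    rw [Finset.mem_compl, mem_nbhd_single, mem_nbhd_single]
    have := hex s
    have := hnot s
    tauto
  have hsum : b u = Fintype.card S - b t := by
    rw [← hMc u, hcompl, Finset.card_compl, hMc t]
  have hsub : nbhd M {t} ⊆ nbhd E {t} := by
    intro s hs
    rw [mem_nbhd_single] at hs ⊢
    exact hME hs
  obtain ⟨Z, hZ, hZc, hZlt⟩ := exists_initial σ (nbhd E {t}) (b t)
    (by rw [← hMc t]; exact Finset.card_le_card hsub)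
  -- items outside `Z` are adjacent to `u`
  have hout : ∀ s, s ∉ Z → (s, u) ∈ E := by
    intro s hs
    by_contra hu
    have hst : (s, t) ∈ M := (hex s).resolve_right fun h => hu (hME h)
    have hss : Z ⊂ nbhd M {t} := by
      refine (Finset.ssubset_iff_of_subset ?_).2 ⟨s, (mem_nbhd_single _ _ _).2 hst, hs⟩
      intro z hz
      rw [mem_nbhd_single]
      refine (hex z).resolve_right fun h => ?_
      have hzt := (mem_nbhd_single _ _ _).1 (hZ hz)
      have h1 := hσ s (hME hst) hu z hzt (hME h)
      have h2 := hZlt z hz s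
        (Finset.mem_sdiff.2 ⟨(mem_nbhd_single _ _ _).2 (hME hst), hs⟩)
      exact lt_asymm h1 h2
    have := Finset.card_lt_card hss
    rw [hMc t, hZc] at this
    exact lt_irrefl _ this
  let M' : Finset (S × Fin 2) := Finset.univ.image fun s => (s, if s ∈ Z then t else u)
  have hmem : ∀ s i, (s, i) ∈ M' ↔ i = if s ∈ Z then t else u := by
    intro s i
    simp only [M', Finset.mem_image, Finset.mem_univ, true_and, Prod.mk.injEq]
    constructor
    · rintro ⟨a, rfl, h⟩
      exact h.symm
    · intro h
      exact ⟨s, rfl, h.symm⟩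
  have hNt : nbhd M' {t} = Z := by
    ext s
    rw [mem_nbhd_single, hmem]
    by_cases h : s ∈ Z <;> simp [h, htu]
  have hNu : nbhd M' {u} = Zᶜ := by
    ext s
    rw [mem_nbhd_single, hmem]
    by_cases h : s ∈ Z <;> simp [h, htu.symm]
  refine ⟨M', ?_, ?_, ?_, ?_⟩
  · rintro ⟨s, i⟩ h
    rw [hmem] at h
    subst h
    by_cases h : s ∈ Z
    · rw [if_pos h]
      exact (mem_nbhd_single _ _ _).1 (hZ h)
    · rw [if_neg h]
      exact hout s h
  · intro s
    unfold degS
    rw [Finset.card_eq_one]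
    refine ⟨(s, if s ∈ Z then t else u), ?_⟩
    ext ⟨a, i⟩
    rw [Finset.mem_filter, hmem, Finset.mem_singleton, Prod.mk.injEq]
    constructor
    · rintro ⟨h, rfl⟩
      exact ⟨rfl, h⟩
    · rintro ⟨rfl, h⟩
      exact ⟨h, rfl⟩
  · intro i
    rw [← card_nbhd_single]
    rcases hall i with rfl | rfl
    · rw [hNt, hZc]
    · rw [hNu, Finset.card_compl, hZc, hsum]
  · rw [hNt]
    exact hZlt

/-- **two buyers.** With two buyers, any ordering in which all items of
`N(t₁) △ N(t₂)` precede all items of `N(t₁) ∩ N(t₂)` is adequate. -/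
theorem stmt19 {S : Type*} [Fintype S] [DecidableEq S]
    (E : Finset (S × Fin 2)) (b : Fin 2 → ℕ) (hb : ∀ i, 0 < b i)
    (hfac : ∃ M ⊆ E, (∀ s, degS M s = 1) ∧ ∀ i, degT M i = b i)
    (σ : S ≃ Fin (Fintype.card S))
    (hσ : ∀ s ∈ (nbhd E {0} \ nbhd E {1}) ∪ (nbhd E {1} \ nbhd E {0}),
      ∀ s' ∈ nbhd E {0} ∩ nbhd E {1}, σ s < σ s') :
    Adequate σ E b := by
  intro t
  have key : ∀ i : Fin 2, i = 0 ∨ i = 1 := by decide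
  rcases key t with rfl | rfl
  · refine adequate_aux E b hfac σ 0 1 (by decide) key ?_
    intro s h1 h2 s' h3 h4
    apply hσ s _ s'
    · simp [mem_nbhd_single, h3, h4]
    · simp [mem_nbhd_single, h1, h2]
  · refine adequate_aux E b hfac σ 1 0 (by decide) (fun i => (key i).symm) ?_
    intro s h1 h2 s' h3 h4
    apply hσ s _ s'
    · simp [mem_nbhd_single, h3, h4]
    · simp [mem_nbhd_single, h1, h2]
end
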